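/- arXiv:1305.4314 — 2 statements merged into one kernel-verified Lean document; each statement's English description precedes it below -/
import Mathlib

section
/- Two-encoder soft covering lemma: Let Q_{UVZ} be a pmf on finite alphabets. For n ≥ 1, draw codebooks B1 = {U^n(l)}_{l=1}^{2^{nR1}} with i.i.d. coordinates ~ Q_U, and for each l draw B2 = {V^n(m,l)}_{m=1}^{2^{nR2}} with coordinates drawn conditionally i.i.d. ~ Q_{V|U}(·|U_i(l)). For fixed codebooks define P(z^n) = 2^{−n(R1+R2)} Σ_{l=1}^{2^{nR1}} Σ_{m=1}^{2^{nR2}} ∏_{k=1}^n Q_{Z|UV}(z_k | U_k(l), V_k(m,l)). If R1 > I(U;Z), R2 > I(U,V;Z) − H(U), and R1 + R2 > I(U,V;Z), then E‖P(z^n) − ∏_{k=1}^n Q_Z(z_k)‖_TV → 0 as n → ∞, where the expectation is over the random codebooks. -/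
open scoped BigOperators
open Finset Filter

noncomputable section

/-- `p` is a probability mass function on the finite type `α`. -/
def IsPmf {α : Type} [Fintype α] (p : α → ℝ) : Prop :=
  (∀ a, 0 ≤ p a) ∧ ∑ a, p a = 1

/-- Total variation distance `‖p − q‖_TV = (1/2) Σ |p − q|`. -/
def TV {α : Type} [Fintype α] (p q : α → ℝ) : ℝ :=
  (∑ a, |p a - q a|) / 2

/-- The distribution (law) of the random variable `f` when the underlying
probability mass function is `p`. -/
def lawOf {Ω α : Type} [Fintype Ω] [DecidableEq α]
    (p : Ω → ℝ) (f : Ω → α) : α → ℝ :=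
  fun a => ∑ ω, if f ω = a then p ω else 0

/-- Shannon entropy (base 2) of a pmf on a finite type. -/
def H2 {α : Type} [Fintype α] (p : α → ℝ) : ℝ :=
  -∑ a, p a * Real.logb 2 (p a)

/-- Entropy `H(X)` of a random variable `X` under the pmf `p`. -/
def ent {Ω α : Type} [Fintype Ω] [Fintype α] [DecidableEq α]
    (p : Ω → ℝ) (X : Ω → α) : ℝ :=
  H2 (lawOf p X)

/-- Mutual information `I(X;Y)` under the pmf `p`. -/
def mi {Ω α β : Type} [Fintype Ω] [Fintype α] [Fintype β]
    [DecidableEq α] [DecidableEq β]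
    (p : Ω → ℝ) (X : Ω → α) (Y : Ω → β) : ℝ :=
  ent p X + ent p Y - ent p (fun ω => (X ω, Y ω))

/-- Conditional mutual information `I(X;Y|W)` under the pmf `p`. -/
def cmi {Ω α β γ : Type} [Fintype Ω] [Fintype α] [Fintype β] [Fintype γ]
    [DecidableEq α] [DecidableEq β] [DecidableEq γ]
    (p : Ω → ℝ) (X : Ω → α) (Y : Ω → β) (W : Ω → γ) : ℝ :=
  ent p (fun ω => (X ω, W ω)) + ent p (fun ω => (Y ω, W ω))
    - ent p (fun ω => (X ω, Y ω, W ω)) - ent p W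

/-- `X` and `Y` are conditionally independent given `W` under `p`
(the Markov chain `X − W − Y`). -/
def CondIndep {Ω α β γ : Type} [Fintype Ω] [Fintype α] [Fintype β] [Fintype γ]
    [DecidableEq α] [DecidableEq β] [DecidableEq γ]
    (p : Ω → ℝ) (X : Ω → α) (Y : Ω → β) (W : Ω → γ) : Prop :=
  ∀ x y w,
    lawOf p (fun ω => (X ω, Y ω, W ω)) (x, y, w) * lawOf p W w
      = lawOf p (fun ω => (X ω, W ω)) (x, w) * lawOf p (fun ω => (Y ω, W ω)) (y, w)

/-- `X` and `Y` are independent under `p`. -/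
def IndepRV {Ω α β : Type} [Fintype Ω] [Fintype α] [Fintype β]
    [DecidableEq α] [DecidableEq β]
    (p : Ω → ℝ) (X : Ω → α) (Y : Ω → β) : Prop :=
  ∀ a b, lawOf p (fun ω => (X ω, Y ω)) (a, b) = lawOf p X a * lawOf p Y b



section IidMoments

variable {β : Type} [Fintype β]

lemma sum_fin_succ_arrow {M : ℕ} (F : (Fin (M + 1) → β) → ℝ) :
    ∑ B, F B = ∑ b, ∑ B : Fin M → β, F (Fin.cons b B) := by
  rw [← Fintype.sum_prod_type', ← (Fin.consEquiv fun _ : Fin (M + 1) => β).sum_comp]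
  rfl

/-- Product weights of a normalised weight function sum to one. -/
lemma sum_prod_iid {ρ : β → ℝ} (hρ : ∑ b, ρ b = 1) (M : ℕ) :
    ∑ B : Fin M → β, ∏ l, ρ (B l) = 1 := by
  induction M with
  | zero => simp
  | succ M ih =>
    simp_rw [sum_fin_succ_arrow, Fin.prod_univ_succ, Fin.cons_zero, Fin.cons_succ, ← mul_sum, ih]
    simpa using hρ

lemma sum_prod_iid_mul_sum {ρ : β → ℝ} (hρ : ∑ b, ρ b = 1) (f : β → ℝ) (M : ℕ) :
    ∑ B : Fin M → β, (∏ l, ρ (B l)) * ∑ l, f (B l) = M * ∑ b, ρ b * f b := by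
  induction M with
  | zero => simp
  | succ M ih =>
    simp_rw [sum_fin_succ_arrow, Fin.prod_univ_succ, Fin.sum_univ_succ, Fin.cons_zero,
      Fin.cons_succ]
    have h : ∀ b, ∑ B : Fin M → β, (ρ b * ∏ l, ρ (B l)) * (f b + ∑ l, f (B l))
        = ρ b * f b + ρ b * (M * ∑ b, ρ b * f b) := by
      intro b
      rw [← ih, mul_sum, ← mul_one (ρ b * f b), ← sum_prod_iid hρ M, mul_sum, ← sum_add_distrib]
      exact sum_congr rfl fun B _ => by ring
    simp_rw [h, sum_add_distrib, ← sum_mul, hρ]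
    push_cast; ring

lemma sum_prod_iid_mul_sq {ρ : β → ℝ} (hρ : ∑ b, ρ b = 1) {f : β → ℝ}
    (hf : ∑ b, ρ b * f b = 0) (M : ℕ) :
    ∑ B : Fin M → β, (∏ l, ρ (B l)) * (∑ l, f (B l)) ^ 2 = M * ∑ b, ρ b * f b ^ 2 := by
  induction M with
  | zero => simp
  | succ M ih =>
    simp_rw [sum_fin_succ_arrow, Fin.prod_univ_succ, Fin.sum_univ_succ, Fin.cons_zero,
      Fin.cons_succ]
    have h : ∀ b, ∑ B : Fin M → β, (ρ b * ∏ l, ρ (B l)) * (f b + ∑ l, f (B l)) ^ 2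
        = ρ b * f b ^ 2 + ρ b * (M * ∑ b, ρ b * f b ^ 2) := by
      intro b
      have h1 := sum_prod_iid_mul_sum hρ f M
      rw [hf, mul_zero] at h1
      have h2 : ∑ B : Fin M → β, (ρ b * ∏ l, ρ (B l)) * (f b + ∑ l, f (B l)) ^ 2
          = ρ b * f b ^ 2 * ∑ B : Fin M → β, ∏ l, ρ (B l)
            + 2 * ρ b * f b * ∑ B : Fin M → β, (∏ l, ρ (B l)) * ∑ l, f (B l)
            + ρ b * ∑ B : Fin M → β, (∏ l, ρ (B l)) * (∑ l, f (B l)) ^ 2 := by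
        simp_rw [mul_sum, ← sum_add_distrib]
        exact sum_congr rfl fun B _ => by ring_nf; simp only [mul_sum, sum_mul]; ring_nf
      rw [h2, h1, ih, sum_prod_iid hρ]
      ring
    simp_rw [h, sum_add_distrib, ← sum_mul, hρ]
    push_cast; ring

/-- The empirical mean of `M` iid samples has variance at most `E[f²] / M`. -/
lemma iid_mean_variance_le {ρ : β → ℝ} (hρ : ∑ b, ρ b = 1) (f : β → ℝ) {M : ℕ} (hM : 0 < M) :
    ∑ B : Fin M → β, (∏ l, ρ (B l)) * ((1 / (M : ℝ)) * ∑ l, f (B l) - ∑ b, ρ b * f b) ^ 2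
      ≤ (1 / (M : ℝ)) * ∑ b, ρ b * f b ^ 2 := by
  set μ := ∑ b, ρ b * f b with hμ
  have hM' : (M : ℝ) ≠ 0 := by positivity
  have hc : ∑ b, ρ b * (f b - μ) = 0 := by
    simp_rw [mul_sub, sum_sub_distrib, ← sum_mul, hρ, ← hμ]; ring
  have h1 := sum_prod_iid_mul_sq hρ hc M
  have h2 : ∀ B : Fin M → β, ((1 / (M : ℝ)) * ∑ l, f (B l) - μ)
      = (1 / (M : ℝ)) * ∑ l, (f (B l) - μ) := by
    intro B
    rw [sum_sub_distrib]
    simp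
    field_simp
  have h3 : ∑ b, ρ b * (f b - μ) ^ 2 = ∑ b, ρ b * f b ^ 2 - μ ^ 2 := by
    have : ∀ b, ρ b * (f b - μ) ^ 2 = ρ b * f b ^ 2 - 2 * μ * (ρ b * f b) + μ ^ 2 * ρ b :=
      fun b => by ring
    simp_rw [this, sum_add_distrib, sum_sub_distrib, ← mul_sum, hρ, ← hμ]; ring
  have h4 : ∑ B : Fin M → β, (∏ l, ρ (B l)) * ((1 / (M : ℝ)) * ∑ l, f (B l) - μ) ^ 2
      = (1 / (M : ℝ)) ^ 2 * ∑ B : Fin M → β, (∏ l, ρ (B l)) * (∑ l, (f (B l) - μ)) ^ 2 := by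
    rw [mul_sum]
    exact sum_congr rfl fun B _ => by rw [h2]; ring
  rw [h4, h1, h3]
  have : (1 / (M : ℝ)) ^ 2 * (M * (∑ b, ρ b * f b ^ 2 - μ ^ 2))
      = (1 / (M : ℝ)) * (∑ b, ρ b * f b ^ 2 - μ ^ 2) := by field_simp
  rw [this]
  gcongr
  nlinarith [sq_nonneg μ]

lemma iid_mean_expectation {ρ : β → ℝ} (hρ : ∑ b, ρ b = 1) (f : β → ℝ) {M : ℕ} (hM : 0 < M) :
    ∑ B : Fin M → β, (∏ l, ρ (B l)) * ((1 / (M : ℝ)) * ∑ l, f (B l)) = ∑ b, ρ b * f b := by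
  have hM' : (M : ℝ) ≠ 0 := by positivity
  simp_rw [mul_left_comm _ (1 / (M : ℝ)), ← mul_sum, sum_prod_iid_mul_sum hρ]
  field_simp

lemma iid_mean_sq_le {ρ : β → ℝ} (hρ : ∑ b, ρ b = 1) (f : β → ℝ) {M : ℕ} (hM : 0 < M) :
    ∑ B : Fin M → β, (∏ l, ρ (B l)) * ((1 / (M : ℝ)) * ∑ l, f (B l)) ^ 2
      ≤ (1 / (M : ℝ)) * ∑ b, ρ b * f b ^ 2 + (∑ b, ρ b * f b) ^ 2 := by
  have h1 := iid_mean_variance_le hρ f hM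
  have h2 := iid_mean_expectation hρ f hM
  set μ := ∑ b, ρ b * f b with hμ
  have h3 : ∑ B : Fin M → β, (∏ l, ρ (B l)) * ((1 / (M : ℝ)) * ∑ l, f (B l) - μ) ^ 2
      = ∑ B : Fin M → β, (∏ l, ρ (B l)) * ((1 / (M : ℝ)) * ∑ l, f (B l)) ^ 2 - μ ^ 2 := by
    have : ∀ B : Fin M → β, (∏ l, ρ (B l)) * ((1 / (M : ℝ)) * ∑ l, f (B l) - μ) ^ 2
        = (∏ l, ρ (B l)) * ((1 / (M : ℝ)) * ∑ l, f (B l)) ^ 2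
          - 2 * μ * ((∏ l, ρ (B l)) * ((1 / (M : ℝ)) * ∑ l, f (B l)))
          + μ ^ 2 * ∏ l, ρ (B l) := fun B => by ring
    simp_rw [this, sum_add_distrib, sum_sub_distrib]
    rw [← mul_sum, ← mul_sum, h2, sum_prod_iid hρ]; ring
  linarith

/-- Jensen's inequality for the square under a finite probability distribution. -/
lemma sum_mul_abs_le_sqrt {ρ : β → ℝ} (h0 : ∀ b, 0 ≤ ρ b) (hρ : ∑ b, ρ b = 1) (f : β → ℝ) :
    ∑ b, ρ b * |f b| ≤ √(∑ b, ρ b * f b ^ 2) := by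
  apply Real.le_sqrt_of_sq_le
  have := Finset.sum_sq_le_sum_mul_sum_of_sq_le_mul univ (r := fun b => ρ b * |f b|) (f := ρ)
    (g := fun b => ρ b * f b ^ 2) (fun b _ => h0 b)
    (fun b _ => mul_nonneg (h0 b) (sq_nonneg _))
    (fun b _ => by rw [mul_pow, sq_abs]; exact le_of_eq (by ring))
  rwa [hρ, one_mul] at this

end IidMoments

section OneShot

variable {X Y Z : Type} [Fintype X] [Fintype Y] [Fintype Z]

lemma sum_prod_arrow {ι α γ : Type} [Fintype ι] [DecidableEq ι] [Fintype α] [Fintype γ]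
    (F : (ι → α) → (ι → γ) → ℝ) :
    ∑ f, ∑ g, F f g = ∑ h : ι → α × γ, F (fun i => (h i).1) (fun i => (h i).2) := by
  rw [← Fintype.sum_prod_type', ← (Equiv.arrowProdEquivProdArrow ι (fun _ => α) fun _ => γ).sum_comp]
  rfl

/-- One-shot superposition soft covering: split the channel as `K = K₁ + K₂`, where `K₁` has
bounded information density with respect to the output distribution. -/
lemma superposition_covering_split {p : X → ℝ} (hp : IsPmf p) {w : X → Y → ℝ}
    (hw : ∀ x, IsPmf (w x)) {K₁ K₂ : X → Y → Z → ℝ} (h₁ : ∀ x y z, 0 ≤ K₁ x y z)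
    (h₂ : ∀ x y z, 0 ≤ K₂ x y z) {q : Z → ℝ} (hq1 : ∑ z, q z = 1)
    (hq : ∀ z, q z = ∑ x, ∑ y, p x * w x y * (K₁ x y z + K₂ x y z))
    {a b : ℝ} (ha : 0 ≤ a) (hb : 0 ≤ b) (hKa : ∀ x y z, K₁ x y z ≤ a * q z)
    (hKb : ∀ x z, ∑ y, w x y * K₁ x y z ≤ b * q z)
    {M N : ℕ} (hM : 0 < M) (hN : 0 < N) :
    ∑ B₁ : Fin M → X, ∑ B₂ : Fin M → Fin N → Y,
      ((∏ l, p (B₁ l)) * ∏ l, ∏ m, w (B₁ l) (B₂ l m)) *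
        TV (fun z => (1 / ((M : ℝ) * N)) *
          ∑ l, ∑ m, (K₁ (B₁ l) (B₂ l m) z + K₂ (B₁ l) (B₂ l m) z)) q
      ≤ √(a / (M * N) + b / M) / 2 + ∑ x, ∑ y, ∑ z, p x * w x y * K₂ x y z := by
  have hM' : (0 : ℝ) < M := by positivity
  have hN' : (0 : ℝ) < N := by positivity
  set ρ : X × (Fin N → Y) → ℝ := fun c => p c.1 * ∏ m, w c.1 (c.2 m) with hρdef
  have hρ0 : ∀ c, 0 ≤ ρ c := fun c =>
    mul_nonneg (hp.1 _) (prod_nonneg fun m _ => (hw _).1 _)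
  have hρ1 : ∑ c, ρ c = 1 := by
    simp_rw [hρdef, Fintype.sum_prod_type, ← mul_sum, sum_prod_iid (hw _).2, mul_one, hp.2]
  set g : (X → Y → Z → ℝ) → Z → X × (Fin N → Y) → ℝ :=
    fun K z c => (1 / (N : ℝ)) * ∑ m, K c.1 (c.2 m) z with hg
  have hEg : ∀ (K : X → Y → Z → ℝ) z,
      ∑ c, ρ c * g K z c = ∑ x, ∑ y, p x * w x y * K x y z := by
    intro K z
    simp_rw [hρdef, hg, Fintype.sum_prod_type, mul_assoc, ← mul_sum]
    refine sum_congr rfl fun x _ => ?_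
    rw [iid_mean_expectation (hw x).2 (fun y => K x y z) hN]
  set q₁ : Z → ℝ := fun z => ∑ x, ∑ y, p x * w x y * K₁ x y z with hq₁
  set q₂ : Z → ℝ := fun z => ∑ x, ∑ y, p x * w x y * K₂ x y z with hq₂
  have hq12 : ∀ z, q z = q₁ z + q₂ z := by
    intro z
    simp_rw [hq, hq₁, hq₂, mul_add, sum_add_distrib]
  have hpw : ∀ x y, 0 ≤ p x * w x y := fun x y => mul_nonneg (hp.1 _) ((hw _).1 _)
  have hq₁0 : ∀ z, 0 ≤ q₁ z := fun z =>
    sum_nonneg fun x _ => sum_nonneg fun y _ => mul_nonneg (hpw x y) (h₁ _ _ _)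
  have hq₂0 : ∀ z, 0 ≤ q₂ z := fun z =>
    sum_nonneg fun x _ => sum_nonneg fun y _ => mul_nonneg (hpw x y) (h₂ _ _ _)
  have hq0 : ∀ z, 0 ≤ q z := fun z => by rw [hq12]; exact add_nonneg (hq₁0 z) (hq₂0 z)
  have hEsq : ∀ z, ∑ c, ρ c * g K₁ z c ^ 2 ≤ (a / N + b) * q z ^ 2 := by
    intro z
    have hx : ∀ x, ∑ c : Fin N → Y, ρ (x, c) * g K₁ z (x, c) ^ 2
        ≤ (a / N + b) * q z * ∑ y, p x * w x y * K₁ x y z := by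
      intro x
      have h := iid_mean_sq_le (hw x).2 (fun y => K₁ x y z) hN
      have hs : ∑ y, w x y * K₁ x y z ^ 2 ≤ a * q z * ∑ y, w x y * K₁ x y z := by
        rw [mul_sum]
        refine sum_le_sum fun y _ => ?_
        have := mul_le_mul_of_nonneg_left (hKa x y z) (mul_nonneg ((hw x).1 y) (h₁ x y z))
        nlinarith
      have hm0 : 0 ≤ ∑ y, w x y * K₁ x y z :=
        sum_nonneg fun y _ => mul_nonneg ((hw x).1 y) (h₁ x y z)
      have hm : (∑ y, w x y * K₁ x y z) ^ 2 ≤ b * q z * ∑ y, w x y * K₁ x y z := by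
        rw [sq]; exact mul_le_mul_of_nonneg_right (hKb x z) hm0
      have e1 : ∑ c : Fin N → Y, ρ (x, c) * g K₁ z (x, c) ^ 2 = p x *
          ∑ c : Fin N → Y, (∏ m, w x (c m)) * ((1 / (N : ℝ)) * ∑ m, K₁ x (c m) z) ^ 2 := by
        simp_rw [hρdef, hg, mul_assoc, ← mul_sum]
      have e2 : ∑ y, p x * w x y * K₁ x y z = p x * ∑ y, w x y * K₁ x y z := by
        simp_rw [mul_sum, mul_assoc]
      rw [e1, e2]
      calc _ ≤ p x * ((1 / N) * (a * q z * ∑ y, w x y * K₁ x y z)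
            + b * q z * ∑ y, w x y * K₁ x y z) := by
            refine mul_le_mul_of_nonneg_left (h.trans ?_) (hp.1 x)
            gcongr
        _ = _ := by ring
    rw [Fintype.sum_prod_type]
    calc _ ≤ ∑ x, (a / N + b) * q z * ∑ y, p x * w x y * K₁ x y z := sum_le_sum fun x _ => hx x
      _ = (a / N + b) * q z * q₁ z := by rw [← mul_sum]
      _ ≤ (a / N + b) * q z * q z := by
          have : q₁ z ≤ q z := by rw [hq12]; linarith [hq₂0 z]
          have := hq0 z
          gcongr
      _ = _ := by ring
  set S := √(a / (M * N) + b / M) with hS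
  have hprod : ∑ B : Fin M → X × (Fin N → Y), ∏ l, ρ (B l) = 1 := sum_prod_iid hρ1 M
  have hprod0 : ∀ B : Fin M → X × (Fin N → Y), 0 ≤ ∏ l, ρ (B l) :=
    fun B => prod_nonneg fun l _ => hρ0 _
  have hz : ∀ z, ∑ B : Fin M → X × (Fin N → Y), (∏ l, ρ (B l)) *
      |(1 / (M : ℝ)) * ∑ l, g K₁ z (B l) + (1 / (M : ℝ)) * ∑ l, g K₂ z (B l) - q z|
      ≤ S * q z + 2 * q₂ z := by
    intro z
    have hv : ∑ B : Fin M → X × (Fin N → Y), (∏ l, ρ (B l)) *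
        |(1 / (M : ℝ)) * ∑ l, g K₁ z (B l) - q₁ z| ≤ S * q z := by
      refine (sum_mul_abs_le_sqrt hprod0 hprod _).trans ?_
      have h := iid_mean_variance_le hρ1 (g K₁ z) hM
      rw [hEg K₁ z] at h
      rw [hS, ← Real.sqrt_sq (hq0 z), ← Real.sqrt_mul (by positivity)]
      refine Real.sqrt_le_sqrt (h.trans ?_)
      calc _ ≤ (1 / (M : ℝ)) * ((a / N + b) * q z ^ 2) := by gcongr; exact hEsq z
        _ = _ := by field_simp
    have he := iid_mean_expectation hρ1 (g K₂ z) hM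
    rw [hEg K₂ z] at he
    calc _ ≤ ∑ B : Fin M → X × (Fin N → Y), ((∏ l, ρ (B l)) *
            |(1 / (M : ℝ)) * ∑ l, g K₁ z (B l) - q₁ z|
            + (∏ l, ρ (B l)) * ((1 / (M : ℝ)) * ∑ l, g K₂ z (B l)) + (∏ l, ρ (B l)) * q₂ z) := by
          refine sum_le_sum fun B _ => ?_
          rw [← mul_add (∏ l, ρ (B l)), ← mul_add (∏ l, ρ (B l))]
          refine mul_le_mul_of_nonneg_left ?_ (hprod0 B)
          have hg0 : 0 ≤ (1 / (M : ℝ)) * ∑ l, g K₂ z (B l) :=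
            mul_nonneg (by positivity) (sum_nonneg fun l _ =>
              mul_nonneg (by positivity) (sum_nonneg fun m _ => h₂ _ _ _))
          rw [hq12]
          have h0 := hq₂0 z
          have := neg_abs_le ((1 / (M : ℝ)) * ∑ l, g K₁ z (B l) - q₁ z)
          have := le_abs_self ((1 / (M : ℝ)) * ∑ l, g K₁ z (B l) - q₁ z)
          rw [abs_le]
          constructor <;> linarith
      _ ≤ _ := by
          rw [sum_add_distrib, sum_add_distrib, he, ← sum_mul, hprod]
          linarith
  have hcomb : ∀ z (B : Fin M → X × (Fin N → Y)),
      (1 / ((M : ℝ) * N)) * ∑ l, ∑ m, (K₁ (B l).1 ((B l).2 m) z + K₂ (B l).1 ((B l).2 m) z)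
        = (1 / (M : ℝ)) * ∑ l, g K₁ z (B l) + (1 / (M : ℝ)) * ∑ l, g K₂ z (B l) := by
    intro z B
    simp_rw [hg, sum_add_distrib, ← mul_sum]
    field_simp
  rw [sum_prod_arrow (ι := Fin M) (α := X) (γ := Fin N → Y)]
  simp_rw [TV, hcomb, ← prod_mul_distrib]
  calc _ = (∑ z, ∑ B : Fin M → X × (Fin N → Y), (∏ l, ρ (B l)) *
      |(1 / (M : ℝ)) * ∑ l, g K₁ z (B l) + (1 / (M : ℝ)) * ∑ l, g K₂ z (B l) - q z|) / 2 := by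
        rw [sum_comm, sum_div]
        refine sum_congr rfl fun B _ => ?_
        rw [← mul_div_assoc, mul_sum]
    _ ≤ (∑ z, (S * q z + 2 * q₂ z)) / 2 := by gcongr with z; exact hz z
    _ = S / 2 + ∑ z, q₂ z := by
        rw [sum_add_distrib, ← mul_sum, ← mul_sum, hq1]; ring
    _ = _ := by
        congr 1
        rw [hq₂, sum_comm]
        exact sum_congr rfl fun x _ => sum_comm

/-- One-shot superposition soft covering in terms of information-density tail probabilities. -/
lemma superposition_covering {p : X → ℝ} (hp : IsPmf p) {w : X → Y → ℝ}
    (hw : ∀ x, IsPmf (w x)) {K : X → Y → Z → ℝ} (hK : ∀ x y, IsPmf (K x y)) {q : Z → ℝ}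
    (hq : ∀ z, q z = ∑ x, ∑ y, p x * w x y * K x y z)
    {L : X → Z → ℝ} (hL : ∀ x z, L x z = ∑ y, w x y * K x y z)
    {a b : ℝ} (ha : 0 ≤ a) (hb : 0 ≤ b)
    {M N : ℕ} (hM : 0 < M) (hN : 0 < N) :
    ∑ B₁ : Fin M → X, ∑ B₂ : Fin M → Fin N → Y,
      ((∏ l, p (B₁ l)) * ∏ l, ∏ m, w (B₁ l) (B₂ l m)) *
        TV (fun z => (1 / ((M : ℝ) * N)) * ∑ l, ∑ m, K (B₁ l) (B₂ l m) z) q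
      ≤ √(a / (M * N) + b / M) / 2
        + (∑ x, ∑ y, ∑ z, if a * q z < K x y z then p x * w x y * K x y z else 0)
        + ∑ x, ∑ y, ∑ z, if b * q z < L x z then p x * w x y * K x y z else 0 := by
  set K₁ : X → Y → Z → ℝ := fun x y z =>
    if a * q z < K x y z ∨ b * q z < L x z then 0 else K x y z with hK₁
  set K₂ : X → Y → Z → ℝ := fun x y z =>
    if a * q z < K x y z ∨ b * q z < L x z then K x y z else 0 with hK₂
  have hpwK : ∀ x y z, 0 ≤ p x * w x y * K x y z := fun x y z =>
    mul_nonneg (mul_nonneg (hp.1 x) ((hw x).1 y)) ((hK x y).1 z)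
  have hadd : ∀ x y z, K₁ x y z + K₂ x y z = K x y z := by
    intro x y z; simp only [hK₁, hK₂]; split_ifs <;> simp
  have h₁ : ∀ x y z, 0 ≤ K₁ x y z := by
    intro x y z; simp only [hK₁]; split_ifs; exacts [le_rfl, (hK x y).1 z]
  have h₂ : ∀ x y z, 0 ≤ K₂ x y z := by
    intro x y z; simp only [hK₂]; split_ifs; exacts [(hK x y).1 z, le_rfl]
  have hq0 : ∀ z, 0 ≤ q z := fun z => by
    rw [hq]; exact sum_nonneg fun x _ => sum_nonneg fun y _ => hpwK x y z
  have hq1 : ∑ z, q z = 1 := by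
    calc ∑ z, q z = ∑ x, ∑ y, ∑ z, p x * w x y * K x y z := by
          simp_rw [hq]
          rw [sum_comm]
          exact sum_congr rfl fun x _ => sum_comm
      _ = 1 := by simp_rw [← mul_sum, (hK _ _).2, mul_one, ← mul_sum, (hw _).2, mul_one, hp.2]
  have hKa : ∀ x y z, K₁ x y z ≤ a * q z := by
    intro x y z
    simp only [hK₁]
    split_ifs with h
    · exact mul_nonneg ha (hq0 z)
    · push Not at h; exact h.1
  have hKb : ∀ x z, ∑ y, w x y * K₁ x y z ≤ b * q z := by
    intro x z
    by_cases h : b * q z < L x z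
    · simp only [hK₁, h, or_true, if_true, mul_zero, sum_const_zero]
      exact mul_nonneg hb (hq0 z)
    · refine le_trans ?_ (not_lt.1 h)
      rw [hL]
      refine sum_le_sum fun y _ => mul_le_mul_of_nonneg_left ?_ ((hw x).1 y)
      linarith [hadd x y z, h₂ x y z]
  have main := superposition_covering_split hp hw h₁ h₂ hq1 (fun z => by simp_rw [hadd]; exact hq z)
    ha hb hKa hKb hM hN
  simp_rw [hadd] at main
  refine main.trans ?_
  rw [add_assoc]
  gcongr
  simp_rw [← sum_add_distrib]
  refine sum_le_sum fun x _ => sum_le_sum fun y _ => sum_le_sum fun z _ => ?_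
  have := hpwK x y z
  simp only [hK₂]
  by_cases hA : a * q z < K x y z <;> by_cases hB : b * q z < L x z <;> simp [hA, hB, this]

end OneShot

section Information

/-- Chebyshev tail bound for the normalised log-likelihood ratio of an iid sequence. -/
lemma iid_density_tail_le {Ω : Type} [Fintype Ω] {P : Ω → ℝ} (hP : IsPmf P) {a b : Ω → ℝ}
    (hab : ∀ ω, P ω ≠ 0 → 0 < a ω ∧ 0 < b ω) {I ε : ℝ}
    (hI : ∑ ω, P ω * Real.logb 2 (a ω / b ω) = I) (hε : 0 < ε) {n : ℕ} (hn : 0 < n) :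
    (∑ x : Fin n → Ω,
      if (2 : ℝ) ^ ((n : ℝ) * (I + ε)) * ∏ k, b (x k) < ∏ k, a (x k) then ∏ k, P (x k) else 0)
      ≤ (∑ ω, P ω * (Real.logb 2 (a ω / b ω) - I) ^ 2) / ε ^ 2 / n := by
  have hn' : (0 : ℝ) < n := by positivity
  have hc : ∑ ω, P ω * (Real.logb 2 (a ω / b ω) - I) = 0 := by
    simp_rw [mul_sub, sum_sub_distrib, ← sum_mul, hP.2, hI]; ring
  have hV := sum_prod_iid_mul_sq hP.2 hc n
  have key : ∀ x : Fin n → Ω,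
      (if (2 : ℝ) ^ ((n : ℝ) * (I + ε)) * ∏ k, b (x k) < ∏ k, a (x k) then ∏ k, P (x k) else 0)
        ≤ (∏ k, P (x k)) * (∑ k, (Real.logb 2 (a (x k) / b (x k)) - I)) ^ 2
          * (1 / ((n : ℝ) * ε) ^ 2) := by
    intro x
    have hP0 : 0 ≤ ∏ k, P (x k) := prod_nonneg fun k _ => hP.1 _
    split_ifs with h
    · by_cases hz : ∏ k, P (x k) = 0
      · simp [hz]
      have hk : ∀ k, P (x k) ≠ 0 := fun k => (prod_ne_zero_iff.1 hz) k (mem_univ k)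
      have hb : 0 < ∏ k, b (x k) := prod_pos fun k _ => (hab _ (hk k)).2
      have h1 : (2 : ℝ) ^ ((n : ℝ) * (I + ε)) < ∏ k, a (x k) / b (x k) := by
        rw [prod_div_distrib]; exact (lt_div_iff₀ hb).2 h
      have h2 : (n : ℝ) * (I + ε) < ∑ k, Real.logb 2 (a (x k) / b (x k)) := by
        rw [← Real.logb_prod]
        · exact (Real.lt_logb_iff_rpow_lt one_lt_two
            (prod_pos fun k _ => div_pos (hab _ (hk k)).1 (hab _ (hk k)).2)).2 h1
        · exact fun k _ => (div_pos (hab _ (hk k)).1 (hab _ (hk k)).2).ne'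
      have h3 : (n : ℝ) * ε ≤ ∑ k, (Real.logb 2 (a (x k) / b (x k)) - I) := by
        rw [sum_sub_distrib]; simp; linarith
      have h4 : 1 ≤ (∑ k, (Real.logb 2 (a (x k) / b (x k)) - I)) ^ 2 * (1 / ((n : ℝ) * ε) ^ 2) := by
        rw [mul_one_div, one_le_div (by positivity)]
        gcongr
      rw [mul_assoc]
      exact le_mul_of_one_le_right hP0 h4
    · positivity
  refine (sum_le_sum fun x _ => key x).trans (le_of_eq ?_)
  rw [← sum_mul, hV]
  field_simp

lemma ent_eq_sum {Ω α : Type} [Fintype Ω] [Fintype α] [DecidableEq α] (p : Ω → ℝ) (X : Ω → α) :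
    ent p X = -∑ ω, p ω * Real.logb 2 (lawOf p X (X ω)) := by
  rw [ent, H2]
  congr 1
  have : ∀ a, lawOf p X a * Real.logb 2 (lawOf p X a)
      = ∑ ω, if X ω = a then p ω * Real.logb 2 (lawOf p X a) else 0 := by
    intro a
    conv_lhs => rw [lawOf, sum_mul]
    exact sum_congr rfl fun ω _ => by split_ifs <;> simp [lawOf]
  simp_rw [this]
  rw [sum_comm]
  simp

lemma lawOf_pos {Ω α : Type} [Fintype Ω] [DecidableEq α] {p : Ω → ℝ} (hp : ∀ ω, 0 ≤ p ω)
    (X : Ω → α) {ω : Ω} (hω : p ω ≠ 0) : 0 < lawOf p X (X ω) := by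
  refine sum_pos' (fun i _ => ?_) ⟨ω, mem_univ _, ?_⟩
  · split_ifs; exacts [hp i, le_rfl]
  · simpa using lt_of_le_of_ne (hp ω) hω.symm

/-- Mutual information as the expected information density. -/
lemma mi_eq_sum {Ω α β : Type} [Fintype Ω] [Fintype α] [Fintype β] [DecidableEq α]
    [DecidableEq β] {p : Ω → ℝ} (hp : ∀ ω, 0 ≤ p ω) (X : Ω → α) (Y : Ω → β) {r : Ω → ℝ}
    (hr : ∀ ω, p ω ≠ 0 → r ω * (lawOf p X (X ω) * lawOf p Y (Y ω))
      = lawOf p (fun ω => (X ω, Y ω)) (X ω, Y ω)) :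
    ∑ ω, p ω * Real.logb 2 (r ω) = mi p X Y := by
  rw [mi, ent_eq_sum, ent_eq_sum, ent_eq_sum, ← neg_add, ← sum_add_distrib, sub_neg_eq_add,
    neg_add_eq_sub, ← sum_sub_distrib]
  refine sum_congr rfl fun ω _ => ?_
  by_cases hω : p ω = 0
  · simp [hω]
  have hX := lawOf_pos hp X hω
  have hY := lawOf_pos hp Y hω
  have hXY := lawOf_pos hp (fun ω => (X ω, Y ω)) hω
  have hr' : r ω ≠ 0 := by
    intro h
    have := hr ω hω
    rw [h, zero_mul] at this
    exact hXY.ne this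
  rw [← hr ω hω, Real.logb_mul hr' (mul_pos hX hY).ne', Real.logb_mul hX.ne' hY.ne']
  ring

end Information

section Product

lemma isPmf_pi {α : Type} [Fintype α] {n : ℕ} {p : Fin n → α → ℝ} (hp : ∀ k, IsPmf (p k)) :
    IsPmf fun x : Fin n → α => ∏ k, p k (x k) :=
  ⟨fun x => prod_nonneg fun k _ => (hp k).1 _, by
    rw [← Fintype.prod_sum]; simp [(hp _).2]⟩

lemma sum_sum_sum_arrow {α β γ : Type} [Fintype α] [Fintype β] [Fintype γ] {n : ℕ}
    (F : (Fin n → α) → (Fin n → β) → (Fin n → γ) → ℝ) :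
    ∑ x, ∑ y, ∑ z, F x y z = ∑ t : Fin n → α × β × γ,
      F (fun k => (t k).1) (fun k => (t k).2.1) (fun k => (t k).2.2) := by
  simp_rw [fun x => sum_prod_arrow (F x)]
  rw [sum_prod_arrow fun x (h : Fin n → β × γ) => F x (fun k => (h k).1) fun k => (h k).2]

end Product

lemma tendsto_two_rpow_mul_of_neg {c : ℝ} (hc : c < 0) :
    Tendsto (fun n : ℕ => (2 : ℝ) ^ ((n : ℝ) * c)) atTop (nhds 0) := by
  have h : ∀ n : ℕ, (2 : ℝ) ^ ((n : ℝ) * c) = ((2 : ℝ) ^ c) ^ n := fun n => by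
    rw [mul_comm, Real.rpow_mul_natCast zero_le_two]
  simp_rw [h]
  exact tendsto_pow_atTop_nhds_zero_of_lt_one (by positivity)
    (Real.rpow_lt_one_of_one_lt_of_neg one_lt_two hc)

/-- **Two-encoder soft covering lemma.**  With joint pmf
`Q_{UVZ}(u,v,z) = Q_U(u) W_V(u)(v) W_Z(u,v)(z)`, superposition codebooks
`B₁ = {U^n(l)}`, `B₂ = {V^n(m,l)}` of sizes `⌈2^{nR1}⌉` and `⌈2^{nR2}⌉`, if
`R1 > I(U;Z)`, `R2 > I(U,V;Z) − H(U)` and `R1 + R2 > I(U,V;Z)`, then the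
expected total variation between the induced output distribution and the iid
distribution `Q_Z^n` vanishes as `n → ∞`. -/
theorem two_encoder_soft_covering
    {𝒰 𝒱 𝒵 : Type} [Fintype 𝒰] [Fintype 𝒱] [Fintype 𝒵]
    [DecidableEq 𝒰] [DecidableEq 𝒱] [DecidableEq 𝒵]
    [Nonempty 𝒰] [Nonempty 𝒱] [Nonempty 𝒵]
    (QU : 𝒰 → ℝ) (WV : 𝒰 → 𝒱 → ℝ) (WZ : 𝒰 → 𝒱 → 𝒵 → ℝ)
    (hQU : IsPmf QU) (hWV : ∀ u, IsPmf (WV u)) (hWZ : ∀ u v, IsPmf (WZ u v))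
    (R1 R2 : ℝ)
    (hR1 : mi (fun w : 𝒰 × 𝒱 × 𝒵 => QU w.1 * WV w.1 w.2.1 * WZ w.1 w.2.1 w.2.2)
        (fun w => w.1) (fun w => w.2.2) < R1)
    (hR2 : mi (fun w : 𝒰 × 𝒱 × 𝒵 => QU w.1 * WV w.1 w.2.1 * WZ w.1 w.2.1 w.2.2)
          (fun w => (w.1, w.2.1)) (fun w => w.2.2)
        - ent (fun w : 𝒰 × 𝒱 × 𝒵 => QU w.1 * WV w.1 w.2.1 * WZ w.1 w.2.1 w.2.2)
          (fun w => w.1) < R2)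
    (hR12 : mi (fun w : 𝒰 × 𝒱 × 𝒵 => QU w.1 * WV w.1 w.2.1 * WZ w.1 w.2.1 w.2.2)
        (fun w => (w.1, w.2.1)) (fun w => w.2.2) < R1 + R2) :
    Tendsto (fun n : ℕ =>
        ∑ B₁ : Fin ⌈(2 : ℝ) ^ ((n : ℝ) * R1)⌉₊ → Fin n → 𝒰,
          ∑ B₂ : Fin ⌈(2 : ℝ) ^ ((n : ℝ) * R1)⌉₊ →
              Fin ⌈(2 : ℝ) ^ ((n : ℝ) * R2)⌉₊ → Fin n → 𝒱,
            ((∏ l, ∏ k, QU (B₁ l k)) *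
              (∏ l, ∏ m, ∏ k, WV (B₁ l k) (B₂ l m k))) *
              TV
                (fun z : Fin n → 𝒵 =>
                  (1 / ((⌈(2 : ℝ) ^ ((n : ℝ) * R1)⌉₊ : ℝ) *
                      (⌈(2 : ℝ) ^ ((n : ℝ) * R2)⌉₊ : ℝ))) *
                    ∑ l, ∑ m, ∏ k, WZ (B₁ l k) (B₂ l m k) (z k))
                (fun z : Fin n → 𝒵 =>
                  ∏ k, ∑ u, ∑ v, QU u * WV u v * WZ u v (z k)))
      atTop (nhds 0) := by
  set P : 𝒰 × 𝒱 × 𝒵 → ℝ := fun w => QU w.1 * WV w.1 w.2.1 * WZ w.1 w.2.1 w.2.2 with hPdef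
  set QZ : 𝒵 → ℝ := fun z => ∑ u, ∑ v, QU u * WV u v * WZ u v z with hQZ
  set L : 𝒰 → 𝒵 → ℝ := fun u z => ∑ v, WV u v * WZ u v z with hLdef
  have hP0 : ∀ w : 𝒰 × 𝒱 × 𝒵, 0 ≤ P w := fun w =>
    mul_nonneg (mul_nonneg (hQU.1 _) ((hWV _).1 _)) ((hWZ _ _).1 _)
  have hP : IsPmf P := by
    refine ⟨hP0, ?_⟩
    simp_rw [hPdef, Fintype.sum_prod_type, ← mul_sum, (hWZ _ _).2, mul_one, ← mul_sum,
      (hWV _).2, mul_one, hQU.2]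
  have lawZ : ∀ w : 𝒰 × 𝒱 × 𝒵, lawOf P (fun w => w.2.2) w.2.2 = QZ w.2.2 := by
    intro w; simp [lawOf, hPdef, hQZ, Fintype.sum_prod_type]
  have lawU : ∀ w : 𝒰 × 𝒱 × 𝒵, lawOf P (fun w => w.1) w.1 = QU w.1 := by
    intro w
    simp only [lawOf, hPdef, Fintype.sum_prod_type]
    rw [sum_eq_single w.1 (fun u _ hu => by simp [hu]) (by simp)]
    simp_rw [if_true, ← mul_sum, (hWZ _ _).2, mul_one, ← mul_sum, (hWV _).2, mul_one]
  have lawUV : ∀ w : 𝒰 × 𝒱 × 𝒵, lawOf P (fun w => (w.1, w.2.1)) (w.1, w.2.1) = QU w.1 * WV w.1 w.2.1 := by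
    intro w
    simp only [lawOf, hPdef, Fintype.sum_prod_type]
    rw [sum_eq_single w.1 (fun u _ hu => by simp [hu]) (by simp),
      sum_eq_single w.2.1 (fun v _ hv => by simp [hv]) (by simp)]
    simp_rw [if_true, ← mul_sum, (hWZ _ _).2, mul_one]
  have lawUZ : ∀ w : 𝒰 × 𝒱 × 𝒵, lawOf P (fun w => (w.1, w.2.2)) (w.1, w.2.2) = QU w.1 * L w.1 w.2.2 := by
    intro w
    simp only [lawOf, hPdef, Fintype.sum_prod_type]
    rw [sum_eq_single w.1 (fun u _ hu => by simp [hu]) (by simp)]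
    simp [hLdef, mul_sum, mul_assoc]
  have lawUVZ : ∀ w : 𝒰 × 𝒱 × 𝒵, lawOf P (fun w => ((w.1, w.2.1), w.2.2)) ((w.1, w.2.1), w.2.2) = P w := by
    intro w
    rw [lawOf, sum_eq_single w (fun t _ ht => ?_) (by simp)]
    · simp
    · rw [if_neg]
      simp only [Prod.mk.injEq, not_and, and_imp]
      exact fun h1 h2 h3 => ht (Prod.ext h1 (Prod.ext h2 h3))
  have hZpos : ∀ w : 𝒰 × 𝒱 × 𝒵, P w ≠ 0 → 0 < QZ w.2.2 := fun w hw => by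
    rw [← lawZ]; exact lawOf_pos hP0 (fun w => w.2.2) hw
  have hUpos : ∀ w : 𝒰 × 𝒱 × 𝒵, P w ≠ 0 → 0 < QU w.1 := fun w hw => by
    rw [← lawU]; exact lawOf_pos hP0 (fun w => w.1) hw
  have hLpos : ∀ w : 𝒰 × 𝒱 × 𝒵, P w ≠ 0 → 0 < L w.1 w.2.2 := fun w hw => by
    have h := lawOf_pos hP0 (fun w => (w.1, w.2.2)) hw
    rw [lawUZ] at h
    exact (pos_iff_pos_of_mul_pos h).1 (hUpos w hw)
  have hWpos : ∀ w : 𝒰 × 𝒱 × 𝒵, P w ≠ 0 → 0 < WZ w.1 w.2.1 w.2.2 := fun w hw =>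
    lt_of_le_of_ne ((hWZ _ _).1 _) (right_ne_zero_of_mul hw).symm
  have hI12 := mi_eq_sum hP0 (fun w => (w.1, w.2.1)) (fun w => w.2.2)
    (r := fun w => WZ w.1 w.2.1 w.2.2 / QZ w.2.2) (fun w hw => by
      rw [lawUV, lawZ, lawUVZ]
      have := (hZpos w hw).ne'
      field_simp
      simp only [hPdef]; ring)
  have hI1 := mi_eq_sum hP0 (fun w => w.1) (fun w => w.2.2)
    (r := fun w => L w.1 w.2.2 / QZ w.2.2) (fun w hw => by
      rw [lawU, lawZ, lawUZ]
      have := (hZpos w hw).ne'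
      field_simp)
  set I12 := mi P (fun w => (w.1, w.2.1)) (fun w => w.2.2)
  set I1 := mi P (fun w => w.1) (fun w => w.2.2)
  obtain ⟨ε, hε, hε12, hε1⟩ : ∃ ε : ℝ, 0 < ε ∧ I12 + ε - (R1 + R2) < 0 ∧ I1 + ε - R1 < 0 := by
    refine ⟨min (R1 + R2 - I12) (R1 - I1) / 2, ?_, ?_, ?_⟩
    · have := lt_min (sub_pos.2 hR12) (sub_pos.2 hR1)
      linarith
    · have := min_le_left (R1 + R2 - I12) (R1 - I1)
      linarith
    · have := min_le_right (R1 + R2 - I12) (R1 - I1)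
      linarith
  set V12 := (∑ w, P w * (Real.logb 2 (WZ w.1 w.2.1 w.2.2 / QZ w.2.2) - I12) ^ 2) / ε ^ 2
  set V1 := (∑ w, P w * (Real.logb 2 (L w.1 w.2.2 / QZ w.2.2) - I1) ^ 2) / ε ^ 2
  have hlim : Tendsto (fun n : ℕ =>
      √((2 : ℝ) ^ ((n : ℝ) * (I12 + ε - (R1 + R2))) + (2 : ℝ) ^ ((n : ℝ) * (I1 + ε - R1))) / 2
        + V12 / n + V1 / n) atTop (nhds 0) := by
    have h := (((tendsto_two_rpow_mul_of_neg hε12).add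
      (tendsto_two_rpow_mul_of_neg hε1)).sqrt.div_const 2).add
      (tendsto_const_div_atTop_nhds_zero_nat V12) |>.add
      (tendsto_const_div_atTop_nhds_zero_nat V1)
    simpa using h
  refine squeeze_zero' (Eventually.of_forall fun n => ?_) ?_ hlim
  · refine sum_nonneg fun B₁ _ => sum_nonneg fun B₂ _ => mul_nonneg (mul_nonneg ?_ ?_) ?_
    · exact prod_nonneg fun l _ => prod_nonneg fun k _ => hQU.1 _
    · exact prod_nonneg fun l _ => prod_nonneg fun m _ => prod_nonneg fun k _ => (hWV _).1 _
    · exact div_nonneg (sum_nonneg fun z _ => abs_nonneg _) zero_le_two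
  filter_upwards [eventually_gt_atTop 0] with n hn
  have hM : 0 < ⌈(2 : ℝ) ^ ((n : ℝ) * R1)⌉₊ := Nat.ceil_pos.2 (by positivity)
  have hN : 0 < ⌈(2 : ℝ) ^ ((n : ℝ) * R2)⌉₊ := Nat.ceil_pos.2 (by positivity)
  have hMle := Nat.le_ceil ((2 : ℝ) ^ ((n : ℝ) * R1))
  have hNle := Nat.le_ceil ((2 : ℝ) ^ ((n : ℝ) * R2))
  have main := superposition_covering (isPmf_pi fun _ : Fin n => hQU)
    (w := fun (x : Fin n → 𝒰) (y : Fin n → 𝒱) => ∏ k, WV (x k) (y k))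
    (fun x => isPmf_pi fun k => hWV (x k))
    (K := fun x y (z : Fin n → 𝒵) => ∏ k, WZ (x k) (y k) (z k))
    (fun x y => isPmf_pi fun k => hWZ (x k) (y k))
    (q := fun z => ∏ k, QZ (z k))
    (fun z => by
      simp_rw [hQZ, ← prod_mul_distrib, Fintype.prod_sum])
    (L := fun x z => ∏ k, L (x k) (z k))
    (fun x z => by simp_rw [hLdef, ← prod_mul_distrib, Fintype.prod_sum])
    (a := (2 : ℝ) ^ ((n : ℝ) * (I12 + ε))) (b := (2 : ℝ) ^ ((n : ℝ) * (I1 + ε)))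
    (by positivity) (by positivity) hM hN
  refine main.trans ?_
  rw [sum_sum_sum_arrow, sum_sum_sum_arrow]
  simp_rw [← prod_mul_distrib]
  refine add_le_add (add_le_add ?_ ?_) ?_
  · refine div_le_div_of_nonneg_right (Real.sqrt_le_sqrt (add_le_add ?_ ?_)) zero_le_two
    · rw [mul_sub, Real.rpow_sub two_pos, mul_add (n : ℝ) R1, Real.rpow_add two_pos]
      gcongr
    · rw [mul_sub, Real.rpow_sub two_pos]
      gcongr
  · exact iid_density_tail_le hP (fun w hw => ⟨hWpos w hw, hZpos w hw⟩) hI12 hε hn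
  · exact iid_density_tail_le hP (fun w hw => ⟨hLpos w hw, hZpos w hw⟩) hI1 hε hn

end
end

section
/- Cardinality reduction: imposing the cardinality bounds in the definition of D does not change the region S_D. Precisely, for any pmf P_{X,Y,Z,U,V} on finite alphabets with (X,Y,Z)-marginal Q_X Q_{YZ|X} and Markov chains X−(U,V)−Y and (X,Y,U)−V−Z, there exists a pmf Γ_{X,Y,Z,U',V'} with the same (X,Y,Z)-marginal, satisfying the same two Markov chains, with |𝒱'| ≤ |𝒳||𝒴||𝒵|+3 and |𝒰'| ≤ |𝒳||𝒴||𝒵||𝒱'|+2, and with I(X;U',V') ≤ I(X;U,V), I(X;V') ≤ I(X;V), and I(X,Y,Z;U',V') ≤ I(X,Y,Z;U,V). -/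
open scoped BigOperators
open Finset Filter

noncomputable section

/-- A `(M0, M1, M2, n)` secure cascade channel synthesis code: randomized
encoders `F : 𝒳^n × [M0] → [M1]`, `Genc : [M1] × [M0] → [M2]` and randomized
decoders `Gdec : [M1] × [M0] → 𝒴^n`, `Hdec : [M2] × [M0] → 𝒵^n`, each given by
a conditional pmf. -/
structure SCCSCode (𝒳 𝒴 𝒵 : Type) [Fintype 𝒳] [Fintype 𝒴] [Fintype 𝒵]
    (n M0 M1 M2 : ℕ) where
  F : (Fin n → 𝒳) → Fin M0 → Fin M1 → ℝ
  Genc : Fin M1 → Fin M0 → Fin M2 → ℝ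
  Gdec : Fin M1 → Fin M0 → (Fin n → 𝒴) → ℝ
  Hdec : Fin M2 → Fin M0 → (Fin n → 𝒵) → ℝ
  F_pmf : ∀ x k, IsPmf (F x k)
  Genc_pmf : ∀ j₁ k, IsPmf (Genc j₁ k)
  Gdec_pmf : ∀ j₁ k, IsPmf (Gdec j₁ k)
  Hdec_pmf : ∀ j₂ k, IsPmf (Hdec j₂ k)

variable {𝒳 𝒴 𝒵 : Type} [Fintype 𝒳] [Fintype 𝒴] [Fintype 𝒵]
  [DecidableEq 𝒳] [DecidableEq 𝒴] [DecidableEq 𝒵]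

/-- The joint distribution of `(X^n, Y^n, Z^n, K, J₁, J₂)` induced by an SCCS
code: `X^n` is iid `QX`, `K` is uniform on `[M0]` independent of `X^n`,
`J₁ = F(X^n,K)`, `J₂ = Genc(J₁,K)`, `Y^n = Gdec(J₁,K)`, `Z^n = Hdec(J₂,K)`. -/
def inducedFull {n M0 M1 M2 : ℕ} (QX : 𝒳 → ℝ) (c : SCCSCode 𝒳 𝒴 𝒵 n M0 M1 M2) :
    (Fin n → 𝒳) × (Fin n → 𝒴) × (Fin n → 𝒵) × Fin M0 × Fin M1 × Fin M2 → ℝ :=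
  fun w =>
    match w with
    | (x, y, z, k, j₁, j₂) =>
      (∏ t, QX (x t)) * (1 / (M0 : ℝ)) * c.F x k j₁ * c.Genc j₁ k j₂ *
        c.Gdec j₁ k y * c.Hdec j₂ k z

/-- The induced joint distribution of `(X^n, Y^n, Z^n, J₁, J₂)` (marginalizing
out the common randomness `K`). -/
def induced {n M0 M1 M2 : ℕ} (QX : 𝒳 → ℝ) (c : SCCSCode 𝒳 𝒴 𝒵 n M0 M1 M2) :
    (Fin n → 𝒳) × (Fin n → 𝒴) × (Fin n → 𝒵) × Fin M1 × Fin M2 → ℝ :=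
  lawOf (inducedFull QX c) (fun w => (w.1, w.2.1, w.2.2.1, w.2.2.2.2.1, w.2.2.2.2.2))

/-- The marginal distribution of the message pair `(J₁, J₂)`. -/
def msgLaw {n M0 M1 M2 : ℕ} (QX : 𝒳 → ℝ) (c : SCCSCode 𝒳 𝒴 𝒵 n M0 M1 M2) :
    Fin M1 × Fin M2 → ℝ :=
  lawOf (inducedFull QX c) (fun w => (w.2.2.2.2.1, w.2.2.2.2.2))

/-- The target distribution: messages carry their own marginal, and
`(X^n,Y^n,Z^n)` is iid `Q_X Q_{YZ|X}` independent of the messages. -/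
def target {n M0 M1 M2 : ℕ} (QX : 𝒳 → ℝ) (QYZ : 𝒳 → 𝒴 × 𝒵 → ℝ)
    (c : SCCSCode 𝒳 𝒴 𝒵 n M0 M1 M2) :
    (Fin n → 𝒳) × (Fin n → 𝒴) × (Fin n → 𝒵) × Fin M1 × Fin M2 → ℝ :=
  fun w =>
    match w with
    | (x, y, z, j₁, j₂) =>
      msgLaw QX c (j₁, j₂) * ∏ t, QX (x t) * QYZ (x t) (y t, z t)

/-- A rate triple `(R0, R1, R2)` is achievable for secure cascade channel
synthesis of `Q_{YZ|X}` from the source `Q_X` if there is a sequence of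
SCCS codes with message/common-randomness alphabets of sizes at most
`2^{nR0}, 2^{nR1}, 2^{nR2}` whose induced distributions approach the target
in total variation. -/
def Achievable (QX : 𝒳 → ℝ) (QYZ : 𝒳 → 𝒴 × 𝒵 → ℝ) (R0 R1 R2 : ℝ) : Prop :=
  ∃ (M0 M1 M2 : ℕ → ℕ) (c : ∀ n, SCCSCode 𝒳 𝒴 𝒵 n (M0 n) (M1 n) (M2 n)),
    (∀ n : ℕ, (M0 n : ℝ) ≤ 2 ^ ((n : ℝ) * R0) ∧
      (M1 n : ℝ) ≤ 2 ^ ((n : ℝ) * R1) ∧ (M2 n : ℝ) ≤ 2 ^ ((n : ℝ) * R2)) ∧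
    Tendsto (fun n => TV (induced QX (c n)) (target QX QYZ (c n))) atTop (nhds 0)

/-- Membership in the set `D`: the `(X,Y,Z)`-marginal of `p` is
`Q_X Q_{YZ|X}`, and the Markov chains `X − (U,V) − Y` and `(X,Y,U) − V − Z`
hold. -/
def InD {𝒰 𝒱 : Type} [Fintype 𝒰] [Fintype 𝒱] [DecidableEq 𝒰] [DecidableEq 𝒱]
    (QX : 𝒳 → ℝ) (QYZ : 𝒳 → 𝒴 × 𝒵 → ℝ)
    (p : 𝒳 × 𝒴 × 𝒵 × 𝒰 × 𝒱 → ℝ) : Prop :=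
  IsPmf p ∧
  (∀ x y z, lawOf p (fun w => (w.1, w.2.1, w.2.2.1)) (x, y, z) = QX x * QYZ x (y, z)) ∧
  CondIndep p (fun w => w.1) (fun w => w.2.1) (fun w => (w.2.2.2.1, w.2.2.2.2)) ∧
  CondIndep p (fun w => (w.1, w.2.1, w.2.2.2.1)) (fun w => w.2.2.1) (fun w => w.2.2.2.2)

/-- The single-letter region `S_D`. -/
def InSD (QX : 𝒳 → ℝ) (QYZ : 𝒳 → 𝒴 × 𝒵 → ℝ) (R0 R1 R2 : ℝ) : Prop :=
  ∃ (nU nV : ℕ) (p : 𝒳 × 𝒴 × 𝒵 × Fin nU × Fin nV → ℝ),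
    nV ≤ Fintype.card 𝒳 * Fintype.card 𝒴 * Fintype.card 𝒵 + 3 ∧
    nU ≤ Fintype.card 𝒳 * Fintype.card 𝒴 * Fintype.card 𝒵 * nV + 2 ∧
    InD QX QYZ p ∧
    mi p (fun w => w.1) (fun w => (w.2.2.2.1, w.2.2.2.2)) ≤ R1 ∧
    mi p (fun w => w.1) (fun w => w.2.2.2.2) ≤ R2 ∧
    mi p (fun w => (w.1, w.2.1, w.2.2.1)) (fun w => (w.2.2.2.1, w.2.2.2.2)) ≤ R0

/-- Conical Carathéodory theorem: a sum of finitely many vectors indexed by `s` with nonnegative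
weights is a nonnegative combination of at most `Fintype.card κ` of them. -/
theorem exists_finset_nonneg_combination {ι κ : Type} [Fintype κ] (f : ι → κ → ℝ)
    (s : Finset ι) (a : ι → ℝ) (ha : ∀ i ∈ s, 0 ≤ a i) :
    ∃ (t : Finset ι) (b : ι → ℝ), #t ≤ Fintype.card κ ∧ (∀ i ∈ t, 0 ≤ b i) ∧
      ∑ i ∈ t, b i • f i = ∑ i ∈ s, a i • f i := by
  classical
  induction s using Finset.strongInduction generalizing a with
  | H s ih =>
    by_cases hs : #s ≤ Fintype.card κ
    · exact ⟨s, a, hs, ha, rfl⟩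
    obtain ⟨g, hg, i₀, hi₀, hpos⟩ : ∃ g : ι → ℝ, ∑ i ∈ s, g i • f i = 0 ∧ ∃ i ∈ s, 0 < g i := by
      have hdep : ¬ LinearIndepOn ℝ f (s : Set ι) := by
        intro h
        have hcard := LinearIndependent.fintype_card_le_finrank h
        simp at hcard
        exact hs hcard
      rw [linearIndepOn_finset_iff] at hdep
      push Not at hdep
      obtain ⟨g, hg, i, hi, hne⟩ := hdep
      rcases lt_or_gt_of_ne hne with h | h
      · exact ⟨-g, by simp [hg], i, hi, by simpa using h⟩
      · exact ⟨g, hg, i, hi, h⟩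
    obtain ⟨j, hj, hmin⟩ := (s.filter fun i => 0 < g i).exists_min_image (fun i => a i / g i)
      ⟨i₀, by simp [hi₀, hpos]⟩
    simp only [Finset.mem_filter] at hj hmin
    have hratio : 0 ≤ a j / g j := div_nonneg (ha j hj.1) hj.2.le
    obtain ⟨t, b, ht, hb, hsum⟩ := ih (s.erase j) (Finset.erase_ssubset hj.1)
      (fun i => a i - a j / g j * g i) (by
        intro i hi
        have hi' := Finset.mem_of_mem_erase hi
        rcases le_or_gt (g i) 0 with h | h
        · nlinarith [ha i hi', mul_nonneg hratio (neg_nonneg.2 h)]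
        · have := (le_div_iff₀ h).1 (hmin i ⟨hi', h⟩)
          linarith)
    refine ⟨t, b, ht, hb, hsum.trans ?_⟩
    rw [Finset.sum_erase _ (by simp [div_mul_cancel₀ _ hj.2.ne'])]
    simp only [sub_smul, mul_smul, Finset.sum_sub_distrib, ← Finset.smul_sum, hg, smul_zero,
      sub_zero]

/-- The sum of a finite family of vectors in `κ → ℝ` is a nonnegative combination of at most
`Fintype.card κ` of them. -/
theorem exists_fin_nonneg_combination {ι κ : Type} [Fintype ι] [Fintype κ] (f : ι → κ → ℝ) :
    ∃ (n : ℕ) (e : Fin n → ι) (a : Fin n → ℝ), n ≤ Fintype.card κ ∧ (∀ i, 0 ≤ a i) ∧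
      ∀ k, ∑ i, a i * f (e i) k = ∑ i, f i k := by
  obtain ⟨t, b, ht, hb, hsum⟩ := exists_finset_nonneg_combination f univ 1 (by simp)
  refine ⟨#t, fun i => t.equivFin.symm i, fun i => b (t.equivFin.symm i), ht,
    fun i => hb _ (t.equivFin.symm i).2, fun k => ?_⟩
  have hk := congrFun hsum k
  simp only [Finset.sum_apply, Pi.smul_apply, smul_eq_mul, Pi.one_apply, one_mul] at hk
  rw [← hk, Equiv.sum_comp t.equivFin.symm (fun i : t => b i * f i k),
    Finset.sum_coe_sort t (fun i => b i * f i k)]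

/-- The contribution to `-H(X|Y)` of one value of `Y`, as a function of the
subdistribution `r` of `X` on that value. -/
def negEntTerm {α : Type} [Fintype α] (r : α → ℝ) : ℝ :=
  ∑ x, r x * Real.logb 2 (r x) - (∑ x, r x) * Real.logb 2 (∑ x, r x)

theorem negEntTerm_const_mul {α : Type} [Fintype α] (c : ℝ) (r : α → ℝ) :
    negEntTerm (fun x => c * r x) = c * negEntTerm r := by
  have hmul : ∀ t : ℝ, c * t * Real.logb 2 (c * t)
      = c * t * Real.logb 2 c + c * (t * Real.logb 2 t) := by
    intro t
    rcases eq_or_ne c 0 with rfl | hc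
    · simp
    rcases eq_or_ne t 0 with rfl | ht
    · simp
    rw [Real.logb_mul hc ht]
    ring
  simp only [negEntTerm, ← Finset.mul_sum, hmul, Finset.sum_add_distrib, ← Finset.sum_mul]
  ring

theorem sum_lawOf_pair {Ω α β : Type} [Fintype Ω] [Fintype α] [DecidableEq α] [DecidableEq β]
    (p : Ω → ℝ) (X : Ω → α) (Y : Ω → β) (y : β) :
    ∑ x, lawOf p (fun ω => (X ω, Y ω)) (x, y) = lawOf p Y y := by
  simp only [lawOf, Prod.mk.injEq, ite_and]
  rw [Finset.sum_comm]
  simp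

theorem mi_eq_ent_add_sum_negEntTerm {Ω α β : Type} [Fintype Ω] [Fintype α] [Fintype β]
    [DecidableEq α] [DecidableEq β] (p : Ω → ℝ) (X : Ω → α) (Y : Ω → β) :
    mi p X Y = ent p X + ∑ y, negEntTerm fun x => lawOf p (fun ω => (X ω, Y ω)) (x, y) := by
  simp only [mi, negEntTerm, sum_lawOf_pair, Finset.sum_sub_distrib, ent, H2,
    Fintype.sum_prod_type_right]
  ring

section Marginals

set_option linter.unusedSectionVars false

variable {𝒰 𝒱 𝒰' 𝒱' : Type} [Fintype 𝒰] [Fintype 𝒱] [DecidableEq 𝒰] [DecidableEq 𝒱]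
  [Fintype 𝒰'] [Fintype 𝒱'] [DecidableEq 𝒰'] [DecidableEq 𝒱']

theorem lawOf_xyz (p : 𝒳 × 𝒴 × 𝒵 × 𝒰 × 𝒱 → ℝ) (x : 𝒳) (y : 𝒴) (z : 𝒵) :
    lawOf p (fun w => (w.1, w.2.1, w.2.2.1)) (x, y, z) = ∑ u, ∑ v, p (x, y, z, u, v) := by
  simp only [lawOf, Fintype.sum_prod_type, Prod.mk.injEq]
  rw [Fintype.sum_eq_single x (by simp +contextual), Fintype.sum_eq_single y (by simp +contextual),
    Fintype.sum_eq_single z (by simp +contextual)]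
  simp

theorem lawOf_x (p : 𝒳 × 𝒴 × 𝒵 × 𝒰 × 𝒱 → ℝ) (x : 𝒳) :
    lawOf p (fun w => w.1) x = ∑ y, ∑ z, ∑ u, ∑ v, p (x, y, z, u, v) := by
  simp only [lawOf, Fintype.sum_prod_type]
  rw [Fintype.sum_eq_single x (by simp +contextual)]
  simp

theorem inD_iff (QX : 𝒳 → ℝ) (QYZ : 𝒳 → 𝒴 × 𝒵 → ℝ) (p : 𝒳 × 𝒴 × 𝒵 × 𝒰 × 𝒱 → ℝ) :
    InD QX QYZ p ↔ IsPmf p ∧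
      (∀ x y z, ∑ u, ∑ v, p (x, y, z, u, v) = QX x * QYZ x (y, z)) ∧
      (∀ x y u v, (∑ z, p (x, y, z, u, v)) * ∑ x, ∑ y, ∑ z, p (x, y, z, u, v)
        = (∑ y, ∑ z, p (x, y, z, u, v)) * ∑ x, ∑ z, p (x, y, z, u, v)) ∧
      (∀ x y u z v, p (x, y, z, u, v) * ∑ x, ∑ y, ∑ z, ∑ u, p (x, y, z, u, v)
        = (∑ z, p (x, y, z, u, v)) * ∑ x, ∑ y, ∑ u, p (x, y, z, u, v)) := by
  simp only [InD, CondIndep, lawOf_xyz]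
  simp [lawOf, Fintype.sum_prod_type, ite_and]

theorem mi_x_uv (p : 𝒳 × 𝒴 × 𝒵 × 𝒰 × 𝒱 → ℝ) :
    mi p (fun w => w.1) (fun w => (w.2.2.2.1, w.2.2.2.2))
      = ent p (fun w => w.1)
        + ∑ u, ∑ v, negEntTerm fun x => ∑ y, ∑ z, p (x, y, z, u, v) := by
  rw [mi_eq_ent_add_sum_negEntTerm, Fintype.sum_prod_type]
  simp [lawOf, Fintype.sum_prod_type, ite_and]

theorem mi_x_v (p : 𝒳 × 𝒴 × 𝒵 × 𝒰 × 𝒱 → ℝ) :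
    mi p (fun w => w.1) (fun w => w.2.2.2.2)
      = ent p (fun w => w.1)
        + ∑ v, negEntTerm fun x => ∑ y, ∑ z, ∑ u, p (x, y, z, u, v) := by
  rw [mi_eq_ent_add_sum_negEntTerm]
  simp [lawOf, Fintype.sum_prod_type, ite_and]

theorem mi_xyz_uv (p : 𝒳 × 𝒴 × 𝒵 × 𝒰 × 𝒱 → ℝ) :
    mi p (fun w => (w.1, w.2.1, w.2.2.1)) (fun w => (w.2.2.2.1, w.2.2.2.2))
      = ent p (fun w => (w.1, w.2.1, w.2.2.1))
        + ∑ u, ∑ v, negEntTerm fun t : 𝒳 × 𝒴 × 𝒵 => p (t.1, t.2.1, t.2.2, u, v) := by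
  rw [mi_eq_ent_add_sum_negEntTerm, Fintype.sum_prod_type]
  simp [lawOf, Fintype.sum_prod_type, Prod.ext_iff, ite_and, Finset.sum_ite_irrel]

theorem isPmf_of_marginal {p : 𝒳 × 𝒴 × 𝒵 × 𝒰 × 𝒱 → ℝ} {q : 𝒳 × 𝒴 × 𝒵 × 𝒰' × 𝒱' → ℝ}
    (hp : IsPmf p) (hq : ∀ w, 0 ≤ q w)
    (h : ∀ x y z, ∑ u, ∑ v, q (x, y, z, u, v) = ∑ u, ∑ v, p (x, y, z, u, v)) : IsPmf q := by
  refine ⟨hq, ?_⟩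
  rw [← hp.2]
  simp only [Fintype.sum_prod_type, h]

theorem ent_x_congr {p : 𝒳 × 𝒴 × 𝒵 × 𝒰 × 𝒱 → ℝ} {q : 𝒳 × 𝒴 × 𝒵 × 𝒰' × 𝒱' → ℝ}
    (h : ∀ x y z, ∑ u, ∑ v, q (x, y, z, u, v) = ∑ u, ∑ v, p (x, y, z, u, v)) :
    ent q (fun w => w.1) = ent p (fun w => w.1) := by
  simp only [ent, H2, lawOf_x, h]

theorem ent_xyz_congr {p : 𝒳 × 𝒴 × 𝒵 × 𝒰 × 𝒱 → ℝ} {q : 𝒳 × 𝒴 × 𝒵 × 𝒰' × 𝒱' → ℝ}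
    (h : ∀ x y z, ∑ u, ∑ v, q (x, y, z, u, v) = ∑ u, ∑ v, p (x, y, z, u, v)) :
    ent q (fun w => (w.1, w.2.1, w.2.2.1)) = ent p (fun w => (w.1, w.2.1, w.2.2.1)) := by
  simp only [ent, H2, Fintype.sum_prod_type, lawOf_xyz, h]

/-- The alphabet of `V` can be reduced to `|𝒳||𝒴||𝒵| + 3` letters by reweighting the letters
of `V`, preserving all three mutual informations. -/
theorem exists_inD_card_v_le (QX : 𝒳 → ℝ) (QYZ : 𝒳 → 𝒴 × 𝒵 → ℝ)
    (p : 𝒳 × 𝒴 × 𝒵 × 𝒰 × 𝒱 → ℝ) (hp : InD QX QYZ p) :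
    ∃ (nV : ℕ) (q : 𝒳 × 𝒴 × 𝒵 × 𝒰 × Fin nV → ℝ),
      nV ≤ Fintype.card 𝒳 * Fintype.card 𝒴 * Fintype.card 𝒵 + 3 ∧
      InD QX QYZ q ∧
      mi q (fun w => w.1) (fun w => (w.2.2.2.1, w.2.2.2.2))
        = mi p (fun w => w.1) (fun w => (w.2.2.2.1, w.2.2.2.2)) ∧
      mi q (fun w => w.1) (fun w => w.2.2.2.2)
        = mi p (fun w => w.1) (fun w => w.2.2.2.2) ∧
      mi q (fun w => (w.1, w.2.1, w.2.2.1)) (fun w => (w.2.2.2.1, w.2.2.2.2))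
        = mi p (fun w => (w.1, w.2.1, w.2.2.1)) (fun w => (w.2.2.2.1, w.2.2.2.2)) := by
  obtain ⟨n, e, a, hn, ha, hsum⟩ := exists_fin_nonneg_combination
    (fun (v : 𝒱) => Sum.elim
      (fun t : 𝒳 × 𝒴 × 𝒵 => ∑ u, p (t.1, t.2.1, t.2.2, u, v))
      ![∑ u, negEntTerm fun x => ∑ y, ∑ z, p (x, y, z, u, v),
        negEntTerm fun x => ∑ y, ∑ z, ∑ u, p (x, y, z, u, v),
        ∑ u, negEntTerm fun t : 𝒳 × 𝒴 × 𝒵 => p (t.1, t.2.1, t.2.2, u, v)])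
  set q : 𝒳 × 𝒴 × 𝒵 × 𝒰 × Fin n → ℝ :=
    fun w => a w.2.2.2.2 * p (w.1, w.2.1, w.2.2.1, w.2.2.2.1, e w.2.2.2.2) with hq
  have hmarg : ∀ x y z, ∑ u, ∑ v, q (x, y, z, u, v) = ∑ u, ∑ v, p (x, y, z, u, v) := by
    intro x y z
    have := hsum (Sum.inl (x, y, z))
    simp only [Sum.elim_inl] at this
    rw [Finset.sum_comm, Finset.sum_comm (s := (univ : Finset 𝒰)) (t := (univ : Finset 𝒱)),
      ← this]
    simp only [hq, Finset.mul_sum]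
  rw [inD_iff] at hp
  obtain ⟨hpmf, hxyz, hci, hci'⟩ := hp
  refine ⟨n, q, ?_, ?_, ?_, ?_, ?_⟩
  · simpa [mul_assoc] using hn
  · rw [inD_iff]
    refine ⟨isPmf_of_marginal hpmf (fun w => mul_nonneg (ha _) (hpmf.1 _)) hmarg,
      fun x y z => (hmarg x y z).trans (hxyz x y z), fun x y u v => ?_, fun x y u z v => ?_⟩
    · simp only [hq, ← Finset.mul_sum]
      linear_combination a v * a v * hci x y u (e v)
    · simp only [hq, ← Finset.mul_sum]
      linear_combination a v * a v * hci' x y u z (e v)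
  · have := hsum (Sum.inr 0)
    simp only [Sum.elim_inr, Matrix.cons_val] at this
    rw [mi_x_uv, mi_x_uv, ent_x_congr hmarg, Finset.sum_comm,
      Finset.sum_comm (s := (univ : Finset 𝒰)) (t := (univ : Finset 𝒱)), ← this]
    simp only [hq, ← Finset.mul_sum, negEntTerm_const_mul]
  · have := hsum (Sum.inr 1)
    simp only [Sum.elim_inr, Matrix.cons_val] at this
    rw [mi_x_v, mi_x_v, ent_x_congr hmarg, ← this]
    simp only [hq, ← Finset.mul_sum, negEntTerm_const_mul]
  · have := hsum (Sum.inr 2)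
    simp only [Sum.elim_inr, Matrix.cons_val] at this
    rw [mi_xyz_uv, mi_xyz_uv, ent_xyz_congr hmarg, Finset.sum_comm,
      Finset.sum_comm (s := (univ : Finset 𝒰)) (t := (univ : Finset 𝒱)), ← this]
    simp only [hq, ← Finset.mul_sum, negEntTerm_const_mul]

/-- The alphabet of `U` can be reduced to `|𝒳||𝒴||𝒵||𝒱| + 2` letters by reweighting the letters
of `U`, preserving the law of `(X, Y, Z, V)` and all three mutual informations. -/
theorem exists_inD_card_u_le (QX : 𝒳 → ℝ) (QYZ : 𝒳 → 𝒴 × 𝒵 → ℝ)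
    (p : 𝒳 × 𝒴 × 𝒵 × 𝒰 × 𝒱 → ℝ) (hp : InD QX QYZ p) :
    ∃ (nU : ℕ) (q : 𝒳 × 𝒴 × 𝒵 × Fin nU × 𝒱 → ℝ),
      nU ≤ Fintype.card 𝒳 * Fintype.card 𝒴 * Fintype.card 𝒵 * Fintype.card 𝒱 + 2 ∧
      InD QX QYZ q ∧
      mi q (fun w => w.1) (fun w => (w.2.2.2.1, w.2.2.2.2))
        = mi p (fun w => w.1) (fun w => (w.2.2.2.1, w.2.2.2.2)) ∧
      mi q (fun w => w.1) (fun w => w.2.2.2.2)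
        = mi p (fun w => w.1) (fun w => w.2.2.2.2) ∧
      mi q (fun w => (w.1, w.2.1, w.2.2.1)) (fun w => (w.2.2.2.1, w.2.2.2.2))
        = mi p (fun w => (w.1, w.2.1, w.2.2.1)) (fun w => (w.2.2.2.1, w.2.2.2.2)) := by
  obtain ⟨n, e, a, hn, ha, hsum⟩ := exists_fin_nonneg_combination
    (fun (u : 𝒰) => Sum.elim
      (fun t : 𝒳 × 𝒴 × 𝒵 × 𝒱 => p (t.1, t.2.1, t.2.2.1, u, t.2.2.2))
      ![∑ v, negEntTerm fun x => ∑ y, ∑ z, p (x, y, z, u, v),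
        ∑ v, negEntTerm fun t : 𝒳 × 𝒴 × 𝒵 => p (t.1, t.2.1, t.2.2, u, v)])
  set q : 𝒳 × 𝒴 × 𝒵 × Fin n × 𝒱 → ℝ :=
    fun w => a w.2.2.2.1 * p (w.1, w.2.1, w.2.2.1, e w.2.2.2.1, w.2.2.2.2) with hq
  have hmargv : ∀ x y z v, ∑ u, q (x, y, z, u, v) = ∑ u, p (x, y, z, u, v) :=
    fun x y z v => hsum (Sum.inl (x, y, z, v))
  have hmarg : ∀ x y z, ∑ u, ∑ v, q (x, y, z, u, v) = ∑ u, ∑ v, p (x, y, z, u, v) := by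
    intro x y z
    rw [Finset.sum_comm, Finset.sum_comm (s := (univ : Finset 𝒰)) (t := (univ : Finset 𝒱))]
    simp only [hmargv]
  rw [inD_iff] at hp
  obtain ⟨hpmf, hxyz, hci, hci'⟩ := hp
  refine ⟨n, q, ?_, ?_, ?_, ?_, ?_⟩
  · simpa [mul_assoc] using hn
  · rw [inD_iff]
    refine ⟨isPmf_of_marginal hpmf (fun w => mul_nonneg (ha _) (hpmf.1 _)) hmarg,
      fun x y z => (hmarg x y z).trans (hxyz x y z), fun x y u v => ?_, fun x y u z v => ?_⟩
    · simp only [hq, ← Finset.mul_sum]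
      linear_combination a u * a u * hci x y (e u) v
    · simp only [hmargv]
      simp only [hq, ← Finset.mul_sum]
      linear_combination a u * hci' x y (e u) z v
  · have := hsum (Sum.inr 0)
    simp only [Sum.elim_inr, Matrix.cons_val] at this
    rw [mi_x_uv, mi_x_uv, ent_x_congr hmarg, ← this]
    simp only [hq, ← Finset.mul_sum, negEntTerm_const_mul]
  · rw [mi_x_v, mi_x_v, ent_x_congr hmarg]
    simp only [hmargv]
  · have := hsum (Sum.inr 1)
    simp only [Sum.elim_inr, Matrix.cons_val] at this
    rw [mi_xyz_uv, mi_xyz_uv, ent_xyz_congr hmarg, ← this]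
    simp only [hq, ← Finset.mul_sum, negEntTerm_const_mul]

end Marginals

/-- **Cardinality reduction.**  Any `P_{XYZUV}` with `(X,Y,Z)`-marginal
`Q_X Q_{YZ|X}` and Markov chains `X − (U,V) − Y`, `(X,Y,U) − V − Z` can be
replaced by `Γ_{XYZU'V'}` with the same marginal and Markov chains, alphabets
of sizes `|𝒱'| ≤ |𝒳||𝒴||𝒵|+3` and `|𝒰'| ≤ |𝒳||𝒴||𝒵||𝒱'|+2`, and no larger
values of `I(X;U,V)`, `I(X;V)` and `I(X,Y,Z;U,V)`. -/
theorem cardinality_reduction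
    {𝒳 𝒴 𝒵 𝒰 𝒱 : Type} [Fintype 𝒳] [Fintype 𝒴] [Fintype 𝒵]
    [Fintype 𝒰] [Fintype 𝒱]
    [DecidableEq 𝒳] [DecidableEq 𝒴] [DecidableEq 𝒵]
    [DecidableEq 𝒰] [DecidableEq 𝒱]
    (QX : 𝒳 → ℝ) (QYZ : 𝒳 → 𝒴 × 𝒵 → ℝ)
    (hQX : IsPmf QX) (hQYZ : ∀ x, IsPmf (QYZ x))
    (p : 𝒳 × 𝒴 × 𝒵 × 𝒰 × 𝒱 → ℝ) (hp : InD QX QYZ p) :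
    ∃ (nU nV : ℕ) (q : 𝒳 × 𝒴 × 𝒵 × Fin nU × Fin nV → ℝ),
      nV ≤ Fintype.card 𝒳 * Fintype.card 𝒴 * Fintype.card 𝒵 + 3 ∧
      nU ≤ Fintype.card 𝒳 * Fintype.card 𝒴 * Fintype.card 𝒵 * nV + 2 ∧
      InD QX QYZ q ∧
      mi q (fun w => w.1) (fun w => (w.2.2.2.1, w.2.2.2.2))
        ≤ mi p (fun w => w.1) (fun w => (w.2.2.2.1, w.2.2.2.2)) ∧
      mi q (fun w => w.1) (fun w => w.2.2.2.2)
        ≤ mi p (fun w => w.1) (fun w => w.2.2.2.2) ∧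
      mi q (fun w => (w.1, w.2.1, w.2.2.1)) (fun w => (w.2.2.2.1, w.2.2.2.2))
        ≤ mi p (fun w => (w.1, w.2.1, w.2.2.1)) (fun w => (w.2.2.2.1, w.2.2.2.2)) := by
  obtain ⟨nV, r, hV, hr, hr₁, hr₂, hr₃⟩ := exists_inD_card_v_le QX QYZ p hp
  obtain ⟨nU, q, hU, hq, hq₁, hq₂, hq₃⟩ := exists_inD_card_u_le QX QYZ r hr
  rw [Fintype.card_fin] at hU
  exact ⟨nU, nV, q, hV, hU, hq, (hq₁.trans hr₁).le, (hq₂.trans hr₂).le, (hq₃.trans hr₃).le⟩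

end
end
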